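/- arXiv:2102.02476 — 2 statements merged into one kernel-verified Lean document; each statement's English description precedes it below -/
import Mathlib

section
/- Let L > 0, let N be a positive integer, and set h = L/N. Let v : ℝ → ℝ have bounded variation on the interval [0, L], with total variation Var(v; [0,L]). Define the piecewise constant mean-value approximation v_h : (0, L) → ℝ by v_h(x) = (1/h) ∫_{(j-1)h}^{jh} v(y) dy whenever x ∈ ((j-1)h, jh], for j = 1, …, N. Then ∫_0^L |v_h(x) − v(x)| dx ≤ h · Var(v; [0,L]). -/
open MeasureTheory

theorem BoundedVariationOn.integrableOn_Icc {v : ℝ → ℝ} {a b : ℝ}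
    (hv : BoundedVariationOn v (Set.Icc a b)) : IntegrableOn v (Set.Icc a b) := by
  obtain ⟨p, q, hp, hq, rfl⟩ := hv.locallyBoundedVariationOn.exists_monotoneOn_sub_monotoneOn
  exact (hp.integrableOn_isCompact isCompact_Icc).sub (hq.integrableOn_isCompact isCompact_Icc)

/-- The mean of a function over an interval differs from any of its values there by at most the
variation. -/
theorem BoundedVariationOn.abs_mean_sub_le {v : ℝ → ℝ} {a b : ℝ} (hab : a < b)
    (hv : BoundedVariationOn v (Set.Icc a b)) {x : ℝ} (hx : x ∈ Set.Icc a b) :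
    |(1 / (b - a)) * (∫ y in Set.Ioc a b, v y) - v x| ≤ (eVariationOn v (Set.Icc a b)).toReal := by
  have hpos : 0 < b - a := sub_pos.2 hab
  have hint : IntegrableOn v (Set.Ioc a b) := hv.integrableOn_Icc.mono_set Set.Ioc_subset_Icc_self
  have hbound : ‖∫ y in Set.Ioc a b, (v y - v x)‖ ≤
      (eVariationOn v (Set.Icc a b)).toReal * (b - a) := by
    have := norm_setIntegral_le_of_norm_le_const (μ := volume) (s := Set.Ioc a b)
      (f := fun y => v y - v x) (by simp)
      fun y hy => hv.dist_le (Set.Ioc_subset_Icc_self hy) hx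
    rwa [Real.volume_real_Ioc_of_le hab.le] at this
  have hsplit : ∫ y in Set.Ioc a b, (v y - v x) = (∫ y in Set.Ioc a b, v y) - (b - a) * v x := by
    rw [integral_sub hint (by simp), setIntegral_const,
      Real.volume_real_Ioc_of_le hab.le, smul_eq_mul]
  rw [hsplit, Real.norm_eq_abs] at hbound
  have hscale : (1 / (b - a)) * (∫ y in Set.Ioc a b, v y) - v x =
      ((∫ y in Set.Ioc a b, v y) - (b - a) * v x) / (b - a) := by
    field_simp
  rwa [hscale, abs_div, abs_of_pos hpos, div_le_iff₀ hpos]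

/-- piecewise-constant mean-value approximation of a BV function on `[0,L]`
satisfies `‖v_h - v‖_{L¹(0,L)} ≤ h · Var(v;[0,L])`. -/
theorem stmt0 (L : ℝ) (hL : 0 < L) (N : ℕ) (hN : 0 < N) (h : ℝ) (hh : h = L / N)
    (v : ℝ → ℝ) (hv : BoundedVariationOn v (Set.Icc 0 L))
    (vh : ℝ → ℝ)
    (hvh : ∀ j : ℕ, j < N → ∀ x ∈ Set.Ioc ((j : ℝ) * h) (((j : ℝ) + 1) * h),
      vh x = (1 / h) * ∫ y in Set.Ioc ((j : ℝ) * h) (((j : ℝ) + 1) * h), v y) :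
    (∫ x in Set.Ioc (0 : ℝ) L, |vh x - v x|) ≤ h * (eVariationOn v (Set.Icc 0 L)).toReal := by
  have hNpos : (0 : ℝ) < N := by exact_mod_cast hN
  have hpos : 0 < h := hh ▸ div_pos hL hNpos
  have hNL : (N : ℝ) * h = L := by rw [hh]; field_simp
  set g : ℕ → ℝ := fun j => j * h with hg
  have hmono : Monotone g := fun i j hij => by
    simp only [hg]; gcongr
  have hsucc (j : ℕ) : ((j : ℝ) + 1) * h = g (j + 1) := by simp [hg]
  have hlen (j : ℕ) : g (j + 1) - g j = h := by simp only [hg]; push_cast; ring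
  have hlt (j : ℕ) : g j < g (j + 1) := by linarith [hlen j]
  have hg0 : g 0 = 0 := by simp [hg]
  have hsub {j : ℕ} (hj : j < N) : Set.Icc (g j) (g (j + 1)) ⊆ Set.Icc 0 L := by
    rw [← hg0, ← hNL]
    exact Set.Icc_subset_Icc (hmono j.zero_le) (hmono (Nat.succ_le_of_lt hj))
  have hvh' {j : ℕ} (hj : j < N) {x : ℝ} (hx : x ∈ Set.Ioc (g j) (g (j + 1))) :
      vh x = (1 / (g (j + 1) - g j)) * ∫ y in Set.Ioc (g j) (g (j + 1)), v y := by
    rw [hlen, ← hsucc]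
    exact hvh j hj x (by rwa [hsucc])
  have hint {j : ℕ} (hj : j < N) :
      IntervalIntegrable (fun x => |vh x - v x|) volume (g j) (g (j + 1)) := by
    rw [intervalIntegrable_iff_integrableOn_Ioc_of_le (hlt j).le]
    refine Integrable.abs (IntegrableOn.congr_fun (Integrable.sub
      (integrableOn_const (C := (1 / (g (j + 1) - g j)) * ∫ y in Set.Ioc (g j) (g (j + 1)), v y)
        (by simp))
      (((hv.mono (hsub hj)).integrableOn_Icc).mono_set Set.Ioc_subset_Icc_self))
      (fun x hx => ?_) measurableSet_Ioc)
    simp [hvh' hj hx]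
  have hcell {j : ℕ} (hj : j < N) : (∫ x in g j..g (j + 1), |vh x - v x|) ≤
      h * (eVariationOn v (Set.Icc (g j) (g (j + 1)))).toReal := by
    have := intervalIntegral.norm_integral_le_of_norm_le_const (a := g j) (b := g (j + 1))
      (f := fun x => |vh x - v x|) (C := (eVariationOn v (Set.Icc (g j) (g (j + 1)))).toReal)
      fun x hx => by
        rw [Set.uIoc_of_le (hlt j).le] at hx
        rw [Real.norm_eq_abs, abs_abs, hvh' hj hx]
        exact (hv.mono (hsub hj)).abs_mean_sub_le (hlt j) (Set.Ioc_subset_Icc_self hx)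
    rw [hlen, abs_of_pos hpos, mul_comm] at this
    exact (le_abs_self _).trans this
  have hvar : ∑ j ∈ Finset.range N, (eVariationOn v (Set.Icc (g j) (g (j + 1)))).toReal =
      (eVariationOn v (Set.Icc 0 L)).toReal := by
    rw [← ENNReal.toReal_sum fun j hj => hv.mono (hsub (Finset.mem_range.1 hj)),
      eVariationOn.sum' v hmono, hg0, ← hNL]
  rw [← intervalIntegral.integral_of_le hL.le, ← hvar, Finset.mul_sum]
  have hsum := intervalIntegral.sum_integral_adjacent_intervals (a := g) (n := N)
    fun j hj => hint hj
  rw [hg0, show g N = L from hNL] at hsum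
  rw [← hsum]
  exact Finset.sum_le_sum fun j hj => hcell (Finset.mem_range.1 hj)
end

section
/- Let 𝐉 be a nonempty finite index set, τ > 0, and let C_A, C_f, K_J > 0. Let M : 𝐉 × 𝐉 → [0, ∞) satisfy Σ_{k ∈ 𝐉} M[j,k] ≤ K_J for every j ∈ 𝐉; let A : ℝ → ℝ satisfy |A(s)| ≤ C_A |s| for all s ∈ ℝ; and for each n ∈ ℕ and j ∈ 𝐉 let f_{n,j} : ℝ → ℝ satisfy |f_{n,j}(s)| ≤ C_f (1 + |s|) for all s ∈ ℝ. Define recursively u^{n+1}[j] = u^n[j] + τ ( Σ_{k ∈ 𝐉} M[j,k] A(u^n[k] − u^n[j]) + f_{n,j}(u^n[j]) ) starting from arbitrary u^0 : 𝐉 → ℝ. Then for every n ∈ ℕ, max_{j ∈ 𝐉} |u^n[j]| ≤ e^{(2 C_A K_J + C_f) τ n} ( max_{j ∈ 𝐉} |u^0[j]| + 1 ). -/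
/-- A kernel with row sums at most `K`, applied to differences of a function bounded by `R`
through a range kernel of growth constant `C`, is bounded by `2 * C * K * R`. -/
theorem abs_sum_mul_kernel_sub_le {ι : Type*} [Fintype ι] {C K R : ℝ} (hC : 0 ≤ C)
    {m : ι → ℝ} (hm0 : ∀ k, 0 ≤ m k) (hm : ∑ k, m k ≤ K)
    {A : ℝ → ℝ} (hA : ∀ s, |A s| ≤ C * |s|) {v : ι → ℝ} (hv : ∀ k, |v k| ≤ R) (j : ι) :
    |∑ k, m k * A (v k - v j)| ≤ 2 * C * K * R := by
  have hR : 0 ≤ R := (abs_nonneg _).trans (hv j)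
  have hdiff (k : ι) : |v k - v j| ≤ 2 * R :=
    (abs_sub _ _).trans (by linarith [hv k, hv j])
  calc |∑ k, m k * A (v k - v j)|
      ≤ ∑ k, |m k * A (v k - v j)| := Finset.abs_sum_le_sum_abs _ _
    _ ≤ ∑ k, m k * (C * (2 * R)) := by
        refine Finset.sum_le_sum fun k _ => ?_
        rw [abs_mul, abs_of_nonneg (hm0 k)]
        exact mul_le_mul_of_nonneg_left
          ((hA _).trans (mul_le_mul_of_nonneg_left (hdiff k) hC)) (hm0 k)
    _ = (∑ k, m k) * (C * (2 * R)) := by rw [Finset.sum_mul]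
    _ ≤ K * (C * (2 * R)) := mul_le_mul_of_nonneg_right hm (by positivity)
    _ = 2 * C * K * R := by ring

/-- uniform L^∞ bound for the explicit time-discretization of the
nonlocal diffusion problem (Lemma 2 of the paper):
`max_j |u^n[j]| ≤ e^{(2 C_A K_J + C_f) τ n} (max_j |u^0[j]| + 1)`. -/
theorem stmt5 {ι : Type*} [Fintype ι] [Nonempty ι] (τ CA Cf KJ : ℝ)
    (hτ : 0 < τ) (hCA : 0 < CA) (hCf : 0 < Cf) (hKJ : 0 < KJ)
    (M : ι → ι → ℝ) (hM0 : ∀ j k, 0 ≤ M j k) (hM : ∀ j, (∑ k, M j k) ≤ KJ)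
    (A : ℝ → ℝ) (hA : ∀ s, |A s| ≤ CA * |s|)
    (f : ℕ → ι → ℝ → ℝ) (hf : ∀ n j s, |f n j s| ≤ Cf * (1 + |s|))
    (u : ℕ → ι → ℝ)
    (hu : ∀ n j, u (n + 1) j
      = u n j + τ * ((∑ k, M j k * A (u n k - u n j)) + f n j (u n j))) :
    ∀ n : ℕ, (Finset.univ.sup' Finset.univ_nonempty fun j => |u n j|)
      ≤ Real.exp ((2 * CA * KJ + Cf) * τ * n)
          * ((Finset.univ.sup' Finset.univ_nonempty fun j => |u 0 j|) + 1) := by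
  set B := Finset.univ.sup' Finset.univ_nonempty fun j => |u 0 j|
  set L := 2 * CA * KJ + Cf
  have key (n : ℕ) : ∀ j, |u n j| ≤ Real.exp (L * τ * n) * (B + 1) - 1 := by
    induction n with
    | zero =>
      intro j
      have hj : |u 0 j| ≤ B := Finset.le_sup' (fun j => |u 0 j|) (Finset.mem_univ j)
      simpa using hj
    | succ n ih =>
      intro j
      set R := Real.exp (L * τ * n) * (B + 1) - 1 with hR
      have hR0 : 0 ≤ R := (abs_nonneg _).trans (ih j)
      have hsum := abs_sum_mul_kernel_sub_le hCA.le (hM0 j) (hM j) hA ih j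
      have hfj : |f n j (u n j)| ≤ Cf * (1 + R) :=
        (hf n j _).trans (by gcongr; exact ih j)
      have hrhs : |(∑ k, M j k * A (u n k - u n j)) + f n j (u n j)| ≤ L * (1 + R) := by
        have hpos : 0 ≤ 2 * CA * KJ := by positivity
        calc _ ≤ 2 * CA * KJ * R + Cf * (1 + R) :=
              (abs_add_le _ _).trans (add_le_add hsum hfj)
          _ ≤ 2 * CA * KJ * (1 + R) + Cf * (1 + R) := by gcongr; linarith
          _ = L * (1 + R) := by ring
      have hstep : |u (n + 1) j| ≤ R + τ * (L * (1 + R)) := by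
        rw [hu]
        refine (abs_add_le _ _).trans (add_le_add (ih j) ?_)
        rw [abs_mul, abs_of_pos hτ]
        gcongr
      have hexp : Real.exp (L * τ * (n + 1 : ℕ)) * (B + 1)
          = Real.exp (L * τ) * (1 + R) := by
        rw [hR, Nat.cast_succ, mul_add_one (L * τ), Real.exp_add]
        ring
      have hgrow : (L * τ + 1) * (1 + R) ≤ Real.exp (L * τ) * (1 + R) := by
        gcongr
        exact Real.add_one_le_exp _
      rw [hexp]
      linarith
  exact fun n => Finset.sup'_le _ _ fun j _ => (key n j).trans (by linarith)
end
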